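/- arXiv:0909.0319 — 2 statements merged into one kernel-verified Lean document; each statement's English description precedes it below -/
import Mathlib

section
/- Let (C₁,κ₁) and (C₂,κ₂) be two coherent pairs on a regular quadratic Lie algebroid 𝒜, and assume C₂ = C₁ + dφ for some φ ∈ C²_↔(𝒜). Then the standard Courant algebroids E^s(C₁,κ₁) and E^s(C₂,κ₂) are isomorphic. -/
/-! # Statement 17
If `(C₁,κ₁)` and `(C₂,κ₂)` are coherent pairs on a regular quadratic Lie algebroid
`𝒜` with `C₂ = C₁ + dφ` for some `φ ∈ C²_↔(𝒜)`, then the standard Courant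
algebroids `E^s(C₁,κ₁)` and `E^s(C₂,κ₂)` are isomorphic.

Algebraic model: `A` plays the role of `C^∞(M)` and vector fields are
`Derivation ℝ A A`. -/

section CE
variable {V A : Type} [CommRing A]

/-- differential of a `1`-form -/
def dCE1 (act : V → A → A) (bk : V → V → V) (ω : V → A) (x₀ x₁ : V) : A :=
  act x₀ (ω x₁) - act x₁ (ω x₀) - ω (bk x₀ x₁)

/-- differential of a `2`-form -/
def dCE2 (act : V → A → A) (bk : V → V → V) (ω : V → V → A) (x₀ x₁ x₂ : V) : A :=
  act x₀ (ω x₁ x₂) - act x₁ (ω x₀ x₂) + act x₂ (ω x₀ x₁)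
    - ω (bk x₀ x₁) x₂ + ω (bk x₀ x₂) x₁ - ω (bk x₁ x₂) x₀

/-- differential of a `3`-form -/
def dCE3 (act : V → A → A) (bk : V → V → V) (ω : V → V → V → A)
    (x₀ x₁ x₂ x₃ : V) : A :=
  act x₀ (ω x₁ x₂ x₃) - act x₁ (ω x₀ x₂ x₃) + act x₂ (ω x₀ x₁ x₃)
    - act x₃ (ω x₀ x₁ x₂)
    - ω (bk x₀ x₁) x₂ x₃ + ω (bk x₀ x₂) x₁ x₃ - ω (bk x₀ x₃) x₁ x₂
    - ω (bk x₁ x₂) x₀ x₃ + ω (bk x₁ x₃) x₀ x₂ - ω (bk x₂ x₃) x₀ x₁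

/-- differential of a `4`-form -/
def dCE4 (act : V → A → A) (bk : V → V → V) (ω : V → V → V → V → A)
    (x₀ x₁ x₂ x₃ x₄ : V) : A :=
  act x₀ (ω x₁ x₂ x₃ x₄) - act x₁ (ω x₀ x₂ x₃ x₄) + act x₂ (ω x₀ x₁ x₃ x₄)
    - act x₃ (ω x₀ x₁ x₂ x₄) + act x₄ (ω x₀ x₁ x₂ x₃)
    - ω (bk x₀ x₁) x₂ x₃ x₄ + ω (bk x₀ x₂) x₁ x₃ x₄ - ω (bk x₀ x₃) x₁ x₂ x₄
    + ω (bk x₀ x₄) x₁ x₂ x₃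
    - ω (bk x₁ x₂) x₀ x₃ x₄ + ω (bk x₁ x₃) x₀ x₂ x₄ - ω (bk x₁ x₄) x₀ x₂ x₃
    - ω (bk x₂ x₃) x₀ x₁ x₄ + ω (bk x₂ x₄) x₀ x₁ x₃
    - ω (bk x₃ x₄) x₀ x₁ x₂

end CE

/-- A Courant algebroid (in algebraic form). -/
structure CourantAlgebroid (A : Type) [CommRing A] [Algebra ℝ A]
    (E : Type) [AddCommGroup E] [Module A E] [Module ℝ E] [IsScalarTower ℝ A E] where
  /-- the pseudo-metric `⟨-,-⟩` -/
  ip : E →ₗ[A] E →ₗ[A] A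
  /-- the anchor `ρ` -/
  rho : E →ₗ[A] Derivation ℝ A A
  /-- the Dorfman bracket `∘` (ℝ-bilinear) -/
  dorf : E →ₗ[ℝ] E →ₗ[ℝ] E
  /-- the map `𝒟 : C^∞(M) → Γ(E)` -/
  Dmap : A → E
  ip_symm : ∀ e₁ e₂, ip e₁ e₂ = ip e₂ e₁
  /-- fiberwise nondegeneracy of the pseudo-metric: `Ξ : E → E*` is bijective -/
  ip_nondeg : Function.Bijective fun e => ip e
  /-- `⟨𝒟f, e⟩ = ½ ρ(e) f` -/
  ip_D : ∀ (f : A) (e : E), (2 : A) * ip (Dmap f) e = rho e f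
  /-- `ρ ∘ 𝒟 = 0` -/
  rho_D : ∀ f : A, rho (Dmap f) = 0
  dorf_jacobi : ∀ e₁ e₂ e₃,
    dorf e₁ (dorf e₂ e₃) = dorf (dorf e₁ e₂) e₃ + dorf e₂ (dorf e₁ e₃)
  rho_dorf : ∀ e₁ e₂, rho (dorf e₁ e₂) = ⁅rho e₁, rho e₂⁆
  dorf_leibniz : ∀ (e₁ : E) (f : A) (e₂ : E),
    dorf e₁ (f • e₂) = rho e₁ f • e₂ + f • dorf e₁ e₂
  dorf_sym : ∀ e₁ e₂, dorf e₁ e₂ + dorf e₂ e₁ = (2 : ℝ) • Dmap (ip e₁ e₂)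
  dorf_D : ∀ (f : A) (e : E), dorf (Dmap f) e = 0
  rho_ip : ∀ e₁ e₂ e₃,
    rho e₁ (ip e₂ e₃) = ip (dorf e₁ e₂) e₃ + ip e₂ (dorf e₁ e₃)

namespace CourantAlgebroid

variable {A : Type} [CommRing A] [Algebra ℝ A]
variable {E : Type} [AddCommGroup E] [Module A E] [Module ℝ E] [IsScalarTower ℝ A E]
variable (ca : CourantAlgebroid A E)

/-- `(ker ρ)⊥`, the subbundle of `E` orthogonal to `ker ρ` w.r.t. the pseudo-metric. -/
def perp : Submodule A E where
  carrier := {e | ∀ k ∈ LinearMap.ker ca.rho, ca.ip e k = 0}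
  add_mem' := by
    intro a b ha hb k hk
    simp [map_add, ha k hk, hb k hk]
  zero_mem' := by intro k hk; simp
  smul_mem' := by
    intro c x hx k hk
    simp [map_smul, hx k hk]

/-- Regularity (constant rank of the anchor), expressed by the splitting of the two
canonical short exact sequences `0 → ker ρ → E → F → 0` and
`0 → (ker ρ)⊥ → ker ρ → 𝒢 → 0`. -/
def IsRegular : Prop :=
  (∃ lam : ↥(LinearMap.range ca.rho) →ₗ[A] E, ∀ x, ca.rho (lam x) = ↑x) ∧
  (∃ sig : (↥(LinearMap.ker ca.rho) ⧸
        (ca.perp.comap (LinearMap.ker ca.rho).subtype)) →ₗ[A] ↥(LinearMap.ker ca.rho),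
      ∀ g, (ca.perp.comap (LinearMap.ker ca.rho).subtype).mkQ (sig g) = g)

lemma dorf_mem_ker {r s : E} (hr : r ∈ LinearMap.ker ca.rho)
    (hs : s ∈ LinearMap.ker ca.rho) : ca.dorf r s ∈ LinearMap.ker ca.rho := by
  rw [LinearMap.mem_ker] at *
  rw [ca.rho_dorf, hr, hs, zero_lie]

lemma dorf_ker_left_mem_ker (e : E) {r : E} (hr : r ∈ LinearMap.ker ca.rho) :
    ca.dorf e r ∈ LinearMap.ker ca.rho := by
  rw [LinearMap.mem_ker] at *
  rw [ca.rho_dorf, hr, lie_zero]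

/-- sections of `ker ρ` -/
abbrev Ker := ↥(LinearMap.ker ca.rho)

/-- `(ker ρ)⊥` viewed inside `ker ρ` -/
abbrev perp' : Submodule A ca.Ker := ca.perp.comap (LinearMap.ker ca.rho).subtype

/-- `𝒢 := ker ρ/(ker ρ)⊥` -/
abbrev Gq := ca.Ker ⧸ ca.perp'

/-- the projection `π : ker ρ → 𝒢` -/
abbrev piG : ca.Ker →ₗ[A] ca.Gq := ca.perp'.mkQ

/-- the ample quotient `𝒜_E := E/(ker ρ)⊥` -/
abbrev Ample := E ⧸ ca.perp

/-- the projection `q : E → 𝒜_E` -/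
abbrev qA : E →ₗ[A] ca.Ample := ca.perp.mkQ

/-- Dorfman bracket of two sections of `ker ρ`, viewed in `ker ρ`. -/
def dorfK (r s : ca.Ker) : ca.Ker := ⟨ca.dorf ↑r ↑s, ca.dorf_mem_ker r.2 s.2⟩

/-- Dorfman bracket of a section of `E` with a section of `ker ρ`, viewed in `ker ρ`. -/
def dorfEK (e : E) (r : ca.Ker) : ca.Ker := ⟨ca.dorf e ↑r, ca.dorf_ker_left_mem_ker e r.2⟩

end CourantAlgebroid

section StandardCA

variable {A : Type} [CommRing A] [Algebra ℝ A]
variable (F : Submodule A (Derivation ℝ A A))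
variable {G : Type} [AddCommGroup G] [Module A G] [Module ℝ G] [IsScalarTower ℝ A G]

/-- the leafwise Lie bracket on the integrable subbundle `F` -/
def fbk (hF : ∀ x y : ↥F, ⁅(x : Derivation ℝ A A), (y : Derivation ℝ A A)⁆ ∈ F)
    (x y : ↥F) : ↥F :=
  ⟨⁅(x : Derivation ℝ A A), (y : Derivation ℝ A A)⁆, hF x y⟩

/-- the action of vector fields tangent to `F` on functions -/
def fact (x : ↥F) (f : A) : A := (x : Derivation ℝ A A) f

/-- A standard Courant algebroid structure on `F*⊕𝒢⊕F`: the anchor is the projection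
onto `F`, the pseudo-metric is `½⟨ξ₁,x₂⟩ + ½⟨ξ₂,x₁⟩ + ⟨r₁,r₂⟩_𝒢`, and the 𝒢-component
of the Dorfman bracket of sections of 𝒢 is the fiberwise bracket `[-,-]_𝒢`. -/
def IsStandardCA (lG : G → G → G) (ipG : G → G → A)
    (ca : CourantAlgebroid A (Module.Dual A ↥F × G × ↥F)) : Prop :=
  (∀ p, ca.rho p = ↑p.2.2) ∧
  (∀ p q, ca.ip p q =
    (2:ℝ)⁻¹ • p.1 q.2.2 + (2:ℝ)⁻¹ • q.1 p.2.2 + ipG p.2.1 q.2.1) ∧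
  (∀ r s : G, (ca.dorf (0, r, 0) (0, s, 0)).2.1 = lG r s)

variable (ca : CourantAlgebroid A (Module.Dual A ↥F × G × ↥F))

/-- the `F`-connection `∇` on `𝒢` induced by a standard Courant algebroid -/
def sNabla (x : ↥F) (r : G) : G := (ca.dorf (0, 0, x) (0, r, 0)).2.1

/-- the curvature-type bundle map `R : ∧²F → 𝒢` induced by a standard Courant algebroid -/
def sR (x y : ↥F) : G := (ca.dorf (0, 0, x) (0, 0, y)).2.1

/-- the 3-form `ℋ ∈ Γ(∧³F*)` induced by a standard Courant algebroid -/
def sH (x y z : ↥F) : A := (ca.dorf (0, 0, x) (0, 0, y)).1 z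

/-- the 4-form `⟨R∧R⟩` on `F` -/
noncomputable def pontR (ipG : G → G → A) (Rm : ↥F → ↥F → G)
    (x₁ x₂ x₃ x₄ : ↥F) : A :=
  (4:ℝ)⁻¹ • ∑ σ : Equiv.Perm (Fin 4),
    (Equiv.Perm.sign σ : ℤ) •
      ipG (Rm (![x₁, x₂, x₃, x₄] (σ 0)) (![x₁, x₂, x₃, x₄] (σ 1)))
          (Rm (![x₁, x₂, x₃, x₄] (σ 2)) (![x₁, x₂, x₃, x₄] (σ 3)))

end StandardCA

/-- A quadratic Lie algebroid (in algebraic form): a Lie algebroid over `A` (playing the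
role of `C^∞(M)`) together with a fiberwise nondegenerate ad-invariant symmetric bilinear
form on the kernel of the anchor (here given as a symmetric bilinear form on `L`,
only its restriction to `ker a` being relevant). -/
structure QuadLieAlgebroid (A : Type) [CommRing A] [Algebra ℝ A]
    (L : Type) [AddCommGroup L] [Module A L] [Module ℝ L] [IsScalarTower ℝ A L] where
  /-- the anchor `a` -/
  anchor : L →ₗ[A] Derivation ℝ A A
  /-- the Lie bracket (ℝ-bilinear) -/
  bracket : L →ₗ[ℝ] L →ₗ[ℝ] L
  bracket_skew : ∀ X Y, bracket X Y = - bracket Y X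
  jacobi : ∀ X Y Z,
    bracket X (bracket Y Z) = bracket (bracket X Y) Z + bracket Y (bracket X Z)
  leibniz : ∀ (X : L) (f : A) (Y : L),
    bracket X (f • Y) = f • bracket X Y + anchor X f • Y
  anchor_bracket : ∀ X Y, anchor (bracket X Y) = ⁅anchor X, anchor Y⁆
  /-- the pairing `⟨-,-⟩_𝒢` on `𝒢 = ker a` -/
  ipG : L →ₗ[A] L →ₗ[A] A
  ipG_symm : ∀ r s, ipG r s = ipG s r
  ipG_nondeg : ∀ r ∈ LinearMap.ker anchor,
    (∀ s ∈ LinearMap.ker anchor, ipG r s = 0) → r = 0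
  /-- `a(X)⟨r,s⟩_𝒢 = ⟨[X,r],s⟩_𝒢 + ⟨r,[X,s]⟩_𝒢` (for `X ∈ ker a` this is
  ad-invariance of the fiberwise pairing) -/
  ipG_inv : ∀ (X r s : L), r ∈ LinearMap.ker anchor → s ∈ LinearMap.ker anchor →
    anchor X (ipG r s) = ipG (bracket X r) s + ipG r (bracket X s)

namespace QuadLieAlgebroid

variable {A : Type} [CommRing A] [Algebra ℝ A]
variable {L : Type} [AddCommGroup L] [Module A L] [Module ℝ L] [IsScalarTower ℝ A L]
variable (Q : QuadLieAlgebroid A L)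

/-- `F := a(𝒜)`, the characteristic distribution. -/
abbrev Fq : Submodule A (Derivation ℝ A A) := LinearMap.range Q.anchor

/-- `𝒢 := ker a`. -/
abbrev Kq : Submodule A L := LinearMap.ker Q.anchor

lemma lie_mem_range (x y : ↥Q.Fq) :
    ⁅(x : Derivation ℝ A A), (y : Derivation ℝ A A)⁆ ∈ Q.Fq := by
  obtain ⟨X, hX⟩ := x.2
  obtain ⟨Y, hY⟩ := y.2
  exact ⟨Q.bracket X Y, by rw [Q.anchor_bracket, hX, hY]⟩

/-- the (leafwise) Lie bracket of vector fields tangent to `F` -/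
def fbk (x y : ↥Q.Fq) : ↥Q.Fq :=
  ⟨⁅(x : Derivation ℝ A A), (y : Derivation ℝ A A)⁆, Q.lie_mem_range x y⟩

/-- the action of vector fields tangent to `F` on functions -/
def fact (x : ↥Q.Fq) (f : A) : A := (x : Derivation ℝ A A) f

lemma bracket_mem_ker (X : L) {r : L} (hr : r ∈ Q.Kq) : Q.bracket X r ∈ Q.Kq := by
  have h : Q.anchor (Q.bracket X r) = ⁅Q.anchor X, Q.anchor r⁆ := Q.anchor_bracket X r
  rw [LinearMap.mem_ker] at hr ⊢
  rw [h, hr, lie_zero]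

/-- A hoist of `𝒜`: a section `κ : F → 𝒜` of the anchor. -/
structure Hoist where
  toFun : ↥Q.Fq →ₗ[A] L
  sect : ∀ x, Q.anchor (toFun x) = ↑x

variable {Q}

/-- The curvature `R^κ(x,y) = [κ(x),κ(y)] − κ([x,y])` of a hoist. -/
def Hoist.curv (κ : Q.Hoist) (x y : ↥Q.Fq) : L :=
  Q.bracket (κ.toFun x) (κ.toFun y) - κ.toFun (Q.fbk x y)

lemma Hoist.curv_mem_ker (κ : Q.Hoist) (x y : ↥Q.Fq) : κ.curv x y ∈ Q.Kq := by
  rw [LinearMap.mem_ker, Hoist.curv, map_sub, Q.anchor_bracket, κ.sect, κ.sect, κ.sect]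
  show ⁅(x : Derivation ℝ A A), (y : Derivation ℝ A A)⁆ - ↑(Q.fbk x y) = 0
  rw [fbk]
  exact sub_self _

variable (Q)

/-- The 4-form `⟨R^κ∧R^κ⟩` representing the first Pontryagin class. -/
noncomputable def pont4 (κ : Q.Hoist) (x₁ x₂ x₃ x₄ : ↥Q.Fq) : A :=
  (4:ℝ)⁻¹ • ∑ σ : Equiv.Perm (Fin 4),
    (Equiv.Perm.sign σ : ℤ) •
      Q.ipG (κ.curv (![x₁, x₂, x₃, x₄] (σ 0)) (![x₁, x₂, x₃, x₄] (σ 1)))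
            (κ.curv (![x₁, x₂, x₃, x₄] (σ 2)) (![x₁, x₂, x₃, x₄] (σ 3)))

end QuadLieAlgebroid

namespace QuadLieAlgebroid

variable {A : Type} [CommRing A] [Algebra ℝ A]
variable {L : Type} [AddCommGroup L] [Module A L] [Module ℝ L] [IsScalarTower ℝ A L]
variable {Q : QuadLieAlgebroid A L}

/-- the fiberwise Lie bracket on `𝒢 = ker a` -/
def lGk (r s : ↥Q.Kq) : ↥Q.Kq := ⟨Q.bracket ↑r ↑s, Q.bracket_mem_ker _ s.2⟩

/-- the connection `∇^κ_x r = [κ(x), r]` induced by a hoist -/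
def Hoist.nabla (κ : Q.Hoist) (x : ↥Q.Fq) (r : ↥Q.Kq) : ↥Q.Kq :=
  ⟨Q.bracket (κ.toFun x) ↑r, Q.bracket_mem_ker _ r.2⟩

/-- the curvature `R^κ` viewed with values in `𝒢 = ker a` -/
def Hoist.curvK (κ : Q.Hoist) (x y : ↥Q.Fq) : ↥Q.Kq := ⟨κ.curv x y, κ.curv_mem_ker x y⟩

/-- modification `κ − J` of a hoist `κ` by a bundle map `J : F → 𝒢` -/
def Hoist.sub (κ : Q.Hoist) (J : ↥Q.Fq →ₗ[A] ↥Q.Kq) : Q.Hoist where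
  toFun := κ.toFun - Q.Kq.subtype.comp J
  sect := by
    intro x
    have hJ : Q.anchor ↑(J x) = 0 := by
      have := (J x).2
      rwa [LinearMap.mem_ker] at this
    simp only [LinearMap.sub_apply, map_sub, LinearMap.comp_apply, Submodule.coe_subtype]
    rw [κ.sect, hJ, sub_zero]

end QuadLieAlgebroid

open QuadLieAlgebroid in
/-- A closed 3-form on a quadratic Lie algebroid which is coherent with respect to the
hoist `κ`. -/
def IsKCoherent
    {A : Type} [CommRing A] [Algebra ℝ A]
    {L : Type} [AddCommGroup L] [Module A L] [Module ℝ L] [IsScalarTower ℝ A L]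
    (Q : QuadLieAlgebroid A L) (C : L → L → L → A) (κ : Q.Hoist) : Prop :=
  (∀ (f : A) X X' Y Z, C (f • X + X') Y Z = f * C X Y Z + C X' Y Z) ∧
  (∀ X Y Z, C X Y Z = - C Y X Z) ∧
  (∀ X Y Z, C X Y Z = - C X Z Y) ∧
  (∀ X₀ X₁ X₂ X₃,
    dCE3 (fun X f => Q.anchor X f) (fun X Y => Q.bracket X Y) C X₀ X₁ X₂ X₃ = 0) ∧
  (∀ r s t, r ∈ Q.Kq → s ∈ Q.Kq → t ∈ Q.Kq → C r s t = - Q.ipG (Q.bracket r s) t) ∧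
  (∀ r s, r ∈ Q.Kq → s ∈ Q.Kq → ∀ x, C r s (κ.toFun x) = 0) ∧
  (∀ r, r ∈ Q.Kq → ∀ x y, C r (κ.toFun x) (κ.toFun y) = Q.ipG r (κ.curv x y))

open QuadLieAlgebroid in
/-- `ca` is (a realization of) the standard Courant algebroid `E^s(𝒜;C,κ)` on
`F*⊕𝒢⊕F` determined by the quintuple `(F,𝒢;∇^κ,R^κ,ℋ^{(C,κ)})`, where
`ℋ^{(C,κ)}(x,y,z) = C(κ(x),κ(y),κ(z))`. -/
def RealizesES
    {A : Type} [CommRing A] [Algebra ℝ A]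
    {L : Type} [AddCommGroup L] [Module A L] [Module ℝ L] [IsScalarTower ℝ A L]
    (Q : QuadLieAlgebroid A L) (C : L → L → L → A) (κ : Q.Hoist)
    (ca : CourantAlgebroid A (Module.Dual A ↥Q.Fq × ↥Q.Kq × ↥Q.Fq)) : Prop :=
  IsStandardCA Q.Fq (fun r s => lGk r s) (fun r s => Q.ipG ↑r ↑s) ca ∧
  (∀ x r, sNabla Q.Fq ca x r = κ.nabla x r) ∧
  (∀ x y, sR Q.Fq ca x y = κ.curvK x y) ∧
  (∀ x y z, sH Q.Fq ca x y z = C (κ.toFun x) (κ.toFun y) (κ.toFun z))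

section Shear
variable {A : Type} [CommRing A] {M G F : Type} [AddCommGroup M] [Module A M]
  [AddCommGroup G] [Module A G] [AddCommGroup F] [Module A F]

/-- The unipotent automorphism `(ξ, r, x) ↦ (ξ + P r + B x, r + K x, x)` of `M ⊕ G ⊕ F`. -/
def shearEquiv (P : G →ₗ[A] M) (B : F →ₗ[A] M) (K : F →ₗ[A] G) :
    (M × G × F) ≃ₗ[A] (M × G × F) where
  toFun p := (p.1 + P p.2.1 + B p.2.2, p.2.1 + K p.2.2, p.2.2)
  invFun p := (p.1 - P (p.2.1 - K p.2.2) - B p.2.2, p.2.1 - K p.2.2, p.2.2)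
  map_add' p q := by
    ext1
    · simp only [Prod.fst_add, Prod.snd_add, map_add]; abel
    · ext1
      · simp only [Prod.fst_add, Prod.snd_add, map_add]; abel
      · rfl
  map_smul' a p := by simp [smul_add]
  left_inv p := by
    ext1
    · simp only [add_sub_cancel_right]; abel
    · ext1
      · exact add_sub_cancel_right _ _
      · rfl
  right_inv p := by
    ext1
    · simp only; abel
    · ext1
      · exact sub_add_cancel _ _
      · rfl

end Shear

section HalfScalar
variable {A : Type} [CommRing A] [Algebra ℝ A]

lemma two_mul_half_smul (a : A) : 2 * ((2 : ℝ)⁻¹ • a) = a := by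
  rw [two_mul, ← two_smul ℝ ((2 : ℝ)⁻¹ • a), smul_smul]
  norm_num

lemma eq_of_two_mul_eq {a b : A} (h : 2 * a = 2 * b) : a = b := by
  have := congrArg (fun c => (2 : ℝ)⁻¹ • c) h
  simpa [two_mul, ← two_smul ℝ, smul_smul] using this

end HalfScalar

namespace CourantAlgebroid
variable {A : Type} [CommRing A] [Algebra ℝ A]
variable {E : Type} [AddCommGroup E] [Module A E] [Module ℝ E] [IsScalarTower ℝ A E]
variable (ca : CourantAlgebroid A E)

lemma ip_dorf_swap_right (p q w : E) :
    ca.ip (ca.dorf p q) w = ca.rho p (ca.ip q w) - ca.ip (ca.dorf p w) q := by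
  rw [ca.rho_ip p q w, ca.ip_symm q (ca.dorf p w)]
  ring

lemma ip_dorf_swap_left (p q w : E) :
    ca.ip (ca.dorf p q) w = ca.rho w (ca.ip p q) - ca.ip (ca.dorf q p) w := by
  have h := congrArg (fun e => ca.ip e w) (ca.dorf_sym p q)
  simp only [two_smul, map_add, LinearMap.add_apply] at h
  linear_combination h + ca.ip_D (ca.ip p q) w

lemma ip_dorf_add (a b c d e f : E) :
    ca.ip (ca.dorf (a + b) (c + d)) (e + f) =
      ca.ip (ca.dorf a (c + d)) (e + f) + ca.ip (ca.dorf b c) (e + f)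
        + ca.ip (ca.dorf b d) e + ca.ip (ca.dorf b d) f := by
  simp only [map_add, LinearMap.add_apply]
  ring

lemma ip_dorf_add_add_add (a b c d e f : E) :
    ca.ip (ca.dorf (a + b) (c + d)) (e + f) =
      ca.ip (ca.dorf a c) e + ca.ip (ca.dorf a c) f
        + ca.ip (ca.dorf a d) e + ca.ip (ca.dorf a d) f
        + ca.ip (ca.dorf b c) e + ca.ip (ca.dorf b c) f
        + ca.ip (ca.dorf b d) e + ca.ip (ca.dorf b d) f := by
  simp only [map_add, LinearMap.add_apply]
  ring

end CourantAlgebroid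

namespace RealizesES
open QuadLieAlgebroid
variable {A : Type} [CommRing A] [Algebra ℝ A]
variable {L : Type} [AddCommGroup L] [Module A L] [Module ℝ L] [IsScalarTower ℝ A L]
variable {Q : QuadLieAlgebroid A L} {C : L → L → L → A} {κ : Q.Hoist}
variable {ca : CourantAlgebroid A (Module.Dual A ↥Q.Fq × ↥Q.Kq × ↥Q.Fq)}

lemma rho_eq (h : RealizesES Q C κ ca) (p) : ca.rho p = ↑p.2.2 := h.1.1 p

lemma two_mul_ip (h : RealizesES Q C κ ca) (p q) :
    2 * ca.ip p q = p.1 q.2.2 + q.1 p.2.2 + 2 * Q.ipG ↑p.2.1 ↑q.2.1 := by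
  rw [h.1.2.1, mul_add, mul_add, two_mul_half_smul, two_mul_half_smul]

lemma dorf_anchor (h : RealizesES Q C κ ca) (p q) :
    (ca.dorf p q).2.2 = Q.fbk p.2.2 q.2.2 := by
  apply Subtype.ext
  rw [← h.rho_eq, ca.rho_dorf, h.rho_eq, h.rho_eq]
  rfl

/-- The Dorfman bracket with a section of `F*` in the last slot. -/
lemma two_mul_ip_dorf_dual_right (h : RealizesES Q C κ ca) (p q) (ζ : Module.Dual A ↥Q.Fq) :
    2 * ca.ip (ca.dorf p q) (ζ, 0, 0) = ζ (Q.fbk p.2.2 q.2.2) := by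
  rw [h.two_mul_ip, h.dorf_anchor]
  simp

lemma two_mul_rho_ip (h : RealizesES Q C κ ca) (p q w) :
    2 * ca.rho w (ca.ip p q) = (w.2.2 : Derivation ℝ A A) (p.1 q.2.2 + q.1 p.2.2 +
      2 * Q.ipG ↑p.2.1 ↑q.2.1) := by
  rw [← h.two_mul_ip, h.rho_eq, two_mul, two_mul, map_add]

lemma two_mul_ip_dorf_dual_mid (h : RealizesES Q C κ ca) (p w) (η : Module.Dual A ↥Q.Fq) :
    2 * ca.ip (ca.dorf p (η, 0, 0)) w =
      (p.2.2 : Derivation ℝ A A) (η w.2.2) - η (Q.fbk p.2.2 w.2.2) := by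
  rw [ca.ip_dorf_swap_right, mul_sub, h.two_mul_ip_dorf_dual_right, h.two_mul_rho_ip]
  simp

lemma two_mul_ip_dorf_dual_left (h : RealizesES Q C κ ca) (q w) (ξ : Module.Dual A ↥Q.Fq) :
    2 * ca.ip (ca.dorf (ξ, 0, 0) q) w =
      (w.2.2 : Derivation ℝ A A) (ξ q.2.2) - (q.2.2 : Derivation ℝ A A) (ξ w.2.2)
        + ξ (Q.fbk q.2.2 w.2.2) := by
  rw [ca.ip_dorf_swap_left, mul_sub, h.two_mul_ip_dorf_dual_mid, h.two_mul_rho_ip]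
  simp
  ring

lemma ip_fib_fib (h : RealizesES Q C κ ca) (p) (t : ↥Q.Kq) :
    ca.ip p (0, t, 0) = Q.ipG ↑p.2.1 ↑t := by
  rw [h.1.2.1]; simp

/-- The Dorfman bracket of `E^s(C,κ)`, tested against an arbitrary section. -/
lemma two_mul_ip_dorf (h : RealizesES Q C κ ca) (ξ η ζ : Module.Dual A ↥Q.Fq) (r s t : ↥Q.Kq)
    (x y z : ↥Q.Fq) :
    2 * ca.ip (ca.dorf (ξ, r, x) (η, s, y)) (ζ, t, z) =
      ζ (Q.fbk x y)
      + ((x : Derivation ℝ A A) (η z) - η (Q.fbk x z))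
      + ((z : Derivation ℝ A A) (ξ y) - (y : Derivation ℝ A A) (ξ z) + ξ (Q.fbk y z))
      + 2 * (Q.ipG (Q.bracket r s) t + Q.ipG (Q.bracket (κ.toFun x) s) t
        - Q.ipG (Q.bracket (κ.toFun y) r) t + Q.ipG (Q.bracket (κ.toFun z) r) s
        + Q.ipG (κ.curv x y) t - Q.ipG (κ.curv x z) s + Q.ipG (κ.curv y z) r)
      + C (κ.toFun x) (κ.toFun y) (κ.toFun z) := by
  have fvz : ∀ (b : ↥Q.Kq) (c : ↥Q.Fq), ca.ip (0, b, 0) (0, 0, c) = 0 := by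
    intro b c; rw [ca.ip_symm, h.ip_fib_fib]; simp
  have fff : ca.ip (ca.dorf (0, r, 0) (0, s, 0)) (0, t, 0) = Q.ipG (Q.bracket r s) t := by
    rw [h.ip_fib_fib, h.1.2.2]; rfl
  have vff : ∀ (a : ↥Q.Fq) (b c : ↥Q.Kq), ca.ip (ca.dorf (0, 0, a) (0, b, 0)) (0, c, 0)
      = Q.ipG (Q.bracket (κ.toFun a) b) c := by
    intro a b c
    rw [h.ip_fib_fib, show (ca.dorf (0, 0, a) (0, b, 0)).2.1 = _ from h.2.1 a b]; rfl
  have vvf : ∀ (a b : ↥Q.Fq) (c : ↥Q.Kq), ca.ip (ca.dorf (0, 0, a) (0, 0, b)) (0, c, 0)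
      = Q.ipG (κ.curv a b) c := by
    intro a b c
    rw [h.ip_fib_fib, show (ca.dorf (0, 0, a) (0, 0, b)).2.1 = _ from h.2.2.1 a b]; rfl
  have vvv : 2 * ca.ip (ca.dorf (0, 0, x) (0, 0, y)) (0, 0, z)
      = C (κ.toFun x) (κ.toFun y) (κ.toFun z) := by
    rw [h.two_mul_ip, show (ca.dorf (0, 0, x) (0, 0, y)).1 z = _ from h.2.2.2 x y z]
    simp
  have vfv : ∀ (a b : ↥Q.Fq) (c : ↥Q.Kq), ca.ip (ca.dorf (0, 0, a) (0, c, 0)) (0, 0, b)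
      = - Q.ipG (κ.curv a b) c := by
    intro a b c
    rw [ca.ip_dorf_swap_right, fvz, vvf]; simp
  have fvf : ca.ip (ca.dorf (0, r, 0) (0, 0, y)) (0, t, 0)
      = - Q.ipG (Q.bracket (κ.toFun y) r) t := by
    rw [ca.ip_dorf_swap_left, fvz, vff]; simp
  have fvv : ca.ip (ca.dorf (0, r, 0) (0, 0, y)) (0, 0, z) = Q.ipG (κ.curv y z) r := by
    rw [ca.ip_dorf_swap_left, fvz, vfv]; simp
  have ffv : ca.ip (ca.dorf (0, r, 0) (0, s, 0)) (0, 0, z)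
      = Q.ipG (Q.bracket (κ.toFun z) r) s := by
    rw [ca.ip_dorf_swap_right, fvz, ca.ip_dorf_swap_left, fvz, vff]; simp
  have e₁ := h.two_mul_ip_dorf_dual_left (η, s, y) (ζ, t, z) ξ
  have e₂ := h.two_mul_ip_dorf_dual_mid (0, r, x) (ζ, t, z) η
  have e₃ := h.two_mul_ip_dorf_dual_right (0, r, x) (0, s, y) ζ
  have d₁ := ca.ip_dorf_add (ξ, 0, 0) (0, r, x) (η, 0, 0) (0, s, y) (ζ, 0, 0) (0, t, z)
  have d₂ := ca.ip_dorf_add_add_add (0, r, 0) (0, 0, x) (0, s, 0) (0, 0, y) (0, t, 0) (0, 0, z)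
  simp only [Prod.mk_add_mk, add_zero, zero_add] at d₁ d₂
  linear_combination 2 * d₁ + 2 * d₂ + e₁ + e₂ + e₃ + vvv
    + 2 * (fff + ffv + fvf + fvv + vff x s t + vfv x z s + vvf x y t)

/-- Bundle maps `F → 𝒢*` are represented by bundle maps `F → 𝒢` through the pairing. -/
lemma exists_ipG_eq (h : RealizesES Q C κ ca) (Ψ : ↥Q.Fq →ₗ[A] Module.Dual A ↥Q.Kq) :
    ∃ j : ↥Q.Fq →ₗ[A] ↥Q.Kq, ∀ x (r : ↥Q.Kq), Q.ipG (j x) r = Ψ x r := by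
  let e := LinearEquiv.ofBijective ca.ip ca.ip_nondeg
  let π : (Module.Dual A ↥Q.Fq × ↥Q.Kq × ↥Q.Fq) →ₗ[A] ↥Q.Kq :=
    LinearMap.fst A _ _ ∘ₗ LinearMap.snd A _ _
  refine ⟨π ∘ₗ e.symm.toLinearMap ∘ₗ Module.Dual.transpose π ∘ₗ Ψ, fun x r => ?_⟩
  have hx : ca.ip (e.symm (Module.Dual.transpose π (Ψ x))) = Module.Dual.transpose π (Ψ x) :=
    e.apply_symm_apply _
  have := h.ip_fib_fib (e.symm (Module.Dual.transpose π (Ψ x))) r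
  rw [hx] at this
  exact this.symm

end RealizesES

namespace QuadLieAlgebroid
variable {A : Type} [CommRing A] [Algebra ℝ A]
variable {L : Type} [AddCommGroup L] [Module A L] [Module ℝ L] [IsScalarTower ℝ A L]
variable (Q : QuadLieAlgebroid A L)

/-- The restriction of the pairing to `𝒢`, as a linear map into `F*` after composition
with `K : F → 𝒢`. -/
def ipComp (K : ↥Q.Fq →ₗ[A] ↥Q.Kq) : ↥Q.Kq →ₗ[A] Module.Dual A ↥Q.Fq :=
  (Q.ipG.domRestrict Q.Kq).compl₂ (Q.Kq.subtype ∘ₗ K)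

@[simp] lemma ipComp_apply (K : ↥Q.Fq →ₗ[A] ↥Q.Kq) (r x) :
    Q.ipComp K r x = Q.ipG ↑r ↑(K x) := rfl

variable {Q}

lemma ipG_bracket_cyc {r s t : L} (hr : r ∈ Q.Kq) (hs : s ∈ Q.Kq) (ht : t ∈ Q.Kq) :
    Q.ipG (Q.bracket r s) t = Q.ipG (Q.bracket s t) r := by
  have h := Q.ipG_inv s r t hr ht
  rw [LinearMap.mem_ker.1 hs, Q.bracket_skew s r, Q.ipG_symm r] at h
  simp only [Derivation.coe_zero, Pi.zero_apply, map_neg, LinearMap.neg_apply] at h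
  linear_combination h + Q.ipG_symm r (Q.bracket s t)

lemma Hoist.ipG_compat (κ : Q.Hoist) (x : ↥Q.Fq) (r s : ↥Q.Kq) :
    (x : Derivation ℝ A A) (Q.ipG r s) =
      Q.ipG (Q.bracket (κ.toFun x) r) s + Q.ipG (Q.bracket (κ.toFun x) s) r := by
  rw [← κ.sect x, Q.ipG_inv _ _ _ r.2 s.2, Q.ipG_symm r]

end QuadLieAlgebroid

namespace RealizesES
open QuadLieAlgebroid
variable {A : Type} [CommRing A] [Algebra ℝ A]
variable {L : Type} [AddCommGroup L] [Module A L] [Module ℝ L] [IsScalarTower ℝ A L]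
variable {Q : QuadLieAlgebroid A L} {C₁ C₂ : L → L → L → A} {κ₁ κ₂ : Q.Hoist}
variable {ca₁ ca₂ : CourantAlgebroid A (Module.Dual A ↥Q.Fq × ↥Q.Kq × ↥Q.Fq)}

set_option maxHeartbeats 1000000 in
/-- A criterion for two standard Courant algebroids to be isomorphic through
`(ξ, r, x) ↦ (ξ + β x - ⟨K x, K -⟩ - 2⟨r, K -⟩, r + K x, x)`. -/
theorem exists_iso_of_shear (h₁ : RealizesES Q C₁ κ₁ ca₁) (h₂ : RealizesES Q C₂ κ₂ ca₂)
    (K : ↥Q.Fq →ₗ[A] ↥Q.Kq) (β : ↥Q.Fq →ₗ[A] Module.Dual A ↥Q.Fq)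
    (hβ : ∀ x y, β x y = - β y x)
    (hN : ∀ x (s t : ↥Q.Kq), Q.ipG (Q.bracket (κ₁.toFun x) s) t =
      Q.ipG (Q.bracket (κ₂.toFun x) s) t + Q.ipG (Q.bracket (K x) s) t)
    (hR : ∀ x y (t : ↥Q.Kq), Q.ipG (κ₁.curv x y) t = Q.ipG (κ₂.curv x y) t
      + Q.ipG (Q.bracket (κ₂.toFun x) (K y)) t - Q.ipG (Q.bracket (κ₂.toFun y) (K x)) t
      - Q.ipG (K (Q.fbk x y)) t + Q.ipG (Q.bracket (K x) (K y)) t)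
    (hH : ∀ x y z, C₁ (κ₁.toFun x) (κ₁.toFun y) (κ₁.toFun z) =
      C₂ (κ₂.toFun x) (κ₂.toFun y) (κ₂.toFun z)
      + dCE2 Q.fact Q.fbk (fun x y => β x y) x y z
      + 2 * (Q.ipG (κ₂.curv x y) (K z) - Q.ipG (κ₂.curv x z) (K y) + Q.ipG (κ₂.curv y z) (K x))
      + (Q.ipG (Q.bracket (κ₂.toFun x) (K y)) (K z) - Q.ipG (Q.bracket (κ₂.toFun y) (K x)) (K z)
        - Q.ipG (K (Q.fbk x y)) (K z))
      - (Q.ipG (Q.bracket (κ₂.toFun x) (K z)) (K y) - Q.ipG (Q.bracket (κ₂.toFun z) (K x)) (K y)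
        - Q.ipG (K (Q.fbk x z)) (K y))
      + (Q.ipG (Q.bracket (κ₂.toFun y) (K z)) (K x) - Q.ipG (Q.bracket (κ₂.toFun z) (K y)) (K x)
        - Q.ipG (K (Q.fbk y z)) (K x))
      + 2 * Q.ipG (Q.bracket (K x) (K y)) (K z)) :
    ∃ Θ : (Module.Dual A ↥Q.Fq × ↥Q.Kq × ↥Q.Fq) ≃ₗ[A]
        (Module.Dual A ↥Q.Fq × ↥Q.Kq × ↥Q.Fq),
      (∀ p, ca₂.rho (Θ p) = ca₁.rho p) ∧
      (∀ p q, ca₂.ip (Θ p) (Θ q) = ca₁.ip p q) ∧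
      (∀ p q, Θ (ca₁.dorf p q) = ca₂.dorf (Θ p) (Θ q)) := by
  let P := -(Q.ipComp K + Q.ipComp K)
  let B := β - Q.ipComp K ∘ₗ K
  let Θ := shearEquiv P B K
  have hΘ : ∀ ξ r x, Θ (ξ, r, x) = (ξ + P r + B x, r + K x, x) := fun _ _ _ => rfl
  have hP : ∀ (r : ↥Q.Kq) y, P r y = -(Q.ipG r (K y) + Q.ipG r (K y)) := fun _ _ => rfl
  have hB : ∀ x y, B x y = β x y - Q.ipG (K x) (K y) := fun _ _ => rfl
  have hip : ∀ p q, ca₂.ip (Θ p) (Θ q) = ca₁.ip p q := by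
    rintro ⟨ξ, r, x⟩ ⟨η, s, y⟩
    apply eq_of_two_mul_eq
    rw [h₁.two_mul_ip, h₂.two_mul_ip, hΘ, hΘ]
    simp only [LinearMap.add_apply, hP, hB, Submodule.coe_add, map_add]
    linear_combination hβ x y + 2 * Q.ipG_symm (K x) s - Q.ipG_symm (K y) (K x)
  refine ⟨Θ, fun p => by rw [h₁.rho_eq, h₂.rho_eq]; rfl, hip, fun p q => ?_⟩
  apply ca₂.ip_nondeg.injective
  refine LinearMap.ext fun w => ?_
  obtain ⟨w, rfl⟩ := Θ.surjective w
  rw [hip]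
  apply eq_of_two_mul_eq
  obtain ⟨ξ, r, x⟩ := p
  obtain ⟨η, s, y⟩ := q
  obtain ⟨ζ, t, z⟩ := w
  rw [hΘ, hΘ, hΘ, h₁.two_mul_ip_dorf, h₂.two_mul_ip_dorf]
  rw [hN, hN, hN, hR, hR, hR, hH]
  simp only [LinearMap.add_apply, hP, hB, Submodule.coe_add, map_add, map_neg, map_sub, dCE2,
    QuadLieAlgebroid.fact, κ₂.ipG_compat]
  have sk := fun a b c => congrArg (fun v => Q.ipG v c) (Q.bracket_skew a b)
  simp only [map_neg, LinearMap.neg_apply] at sk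
  have c₁ := ipG_bracket_cyc r.2 s.2 (K z).2
  have c₂ := ipG_bracket_cyc s.2 (K z).2 r.2
  have c₃ := ipG_bracket_cyc (K x).2 s.2 (K z).2
  have c₄ := ipG_bracket_cyc s.2 (K z).2 (K x).2
  have c₅ := ipG_bracket_cyc r.2 (K y).2 (K z).2
  have sy := fun a b : ↥Q.Kq => Q.ipG_symm a b
  linear_combination -2 * sk r (K y) t - 2 * (c₁ + c₂) - 2 * (c₃ + c₄) - 2 * sk (K x) (K z) s
    - 2 * c₅ + 2 * sy t (K (Q.fbk x y)) - 2 * sy s (K (Q.fbk x z)) + 2 * sy r (K (Q.fbk y z))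
    + sy (K z) (K (Q.fbk x y)) - sy (K y) (K (Q.fbk x z)) + sy (K x) (K (Q.fbk y z))
    - hβ z (Q.fbk x y) + hβ y (Q.fbk x z) - hβ x (Q.fbk y z)

end RealizesES

namespace QuadLieAlgebroid
variable {A : Type} [CommRing A] [Algebra ℝ A]
variable {L : Type} [AddCommGroup L] [Module A L] [Module ℝ L] [IsScalarTower ℝ A L]
variable {Q : QuadLieAlgebroid A L} {κ κ₁ κ₂ : Q.Hoist}

lemma Hoist.bracket_eq (κ : Q.Hoist) (x y : ↥Q.Fq) :
    Q.bracket (κ.toFun x) (κ.toFun y) = κ.toFun (Q.fbk x y) + κ.curv x y := by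
  rw [Hoist.curv]; abel

lemma Hoist.curv_eq_of_eq_add {J : ↥Q.Fq →ₗ[A] ↥Q.Kq} (hJ : ∀ x, κ₁.toFun x = κ₂.toFun x + J x)
    (x y : ↥Q.Fq) :
    κ₁.curv x y = κ₂.curv x y + Q.bracket (κ₂.toFun x) (J y) - Q.bracket (κ₂.toFun y) (J x)
      - J (Q.fbk x y) + Q.bracket (J x) (J y) := by
  rw [Hoist.curv, Hoist.curv, hJ, hJ, hJ, Q.bracket_skew (κ₂.toFun y) (J x)]
  simp only [map_add, LinearMap.add_apply]
  abel

lemma Hoist.exists_eq_add (κ₁ κ₂ : Q.Hoist) :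
    ∃ J : ↥Q.Fq →ₗ[A] ↥Q.Kq, ∀ x, κ₁.toFun x = κ₂.toFun x + J x := by
  refine ⟨(κ₁.toFun - κ₂.toFun).codRestrict Q.Kq fun x => ?_, fun x => ?_⟩
  · rw [LinearMap.mem_ker, LinearMap.sub_apply, map_sub, κ₁.sect, κ₂.sect, sub_self]
  · simp

end QuadLieAlgebroid

namespace IsKCoherent
open QuadLieAlgebroid
variable {A : Type} [CommRing A] [Algebra ℝ A]
variable {L : Type} [AddCommGroup L] [Module A L] [Module ℝ L] [IsScalarTower ℝ A L]
variable {Q : QuadLieAlgebroid A L} {C C₁ C₂ : L → L → L → A} {κ κ₁ κ₂ : Q.Hoist}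

lemma swap_left (h : IsKCoherent Q C κ) (X Y Z : L) : C X Y Z = - C Y X Z := h.2.1 X Y Z

lemma swap_right (h : IsKCoherent Q C κ) (X Y Z : L) : C X Y Z = - C X Z Y := h.2.2.1 X Y Z

lemma add_left (h : IsKCoherent Q C κ) (X X' Y Z : L) : C (X + X') Y Z = C X Y Z + C X' Y Z := by
  have := h.1 1 X X' Y Z
  rwa [one_smul, one_mul] at this

lemma add_mid (h : IsKCoherent Q C κ) (X Y Y' Z : L) : C X (Y + Y') Z = C X Y Z + C X Y' Z := by
  rw [h.swap_left, h.add_left, h.swap_left X Y, h.swap_left X Y']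
  ring

lemma add_right (h : IsKCoherent Q C κ) (X Y Z Z' : L) : C X Y (Z + Z') = C X Y Z + C X Y Z' := by
  rw [h.swap_right, h.add_mid, h.swap_right X Y Z, h.swap_right X Y Z']
  ring

lemma fib_fib_fib (h : IsKCoherent Q C κ) (r s t : ↥Q.Kq) :
    C r s t = - Q.ipG (Q.bracket r s) t := h.2.2.2.2.1 r s t r.2 s.2 t.2

lemma fib_fib_vec (h : IsKCoherent Q C κ) (r s : ↥Q.Kq) (x : ↥Q.Fq) :
    C r s (κ.toFun x) = 0 := h.2.2.2.2.2.1 r s r.2 s.2 x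

lemma fib_vec_fib (h : IsKCoherent Q C κ) (r s : ↥Q.Kq) (x : ↥Q.Fq) :
    C r (κ.toFun x) s = 0 := by rw [h.swap_right, h.fib_fib_vec, neg_zero]

lemma vec_fib_fib (h : IsKCoherent Q C κ) (r s : ↥Q.Kq) (x : ↥Q.Fq) :
    C (κ.toFun x) r s = 0 := by rw [h.swap_left, h.fib_vec_fib, neg_zero]

lemma fib_vec_vec (h : IsKCoherent Q C κ) (r : ↥Q.Kq) (x y : ↥Q.Fq) :
    C r (κ.toFun x) (κ.toFun y) = Q.ipG (κ.curv x y) r := by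
  rw [h.2.2.2.2.2.2 r r.2, Q.ipG_symm]

lemma vec_fib_vec (h : IsKCoherent Q C κ) (r : ↥Q.Kq) (x y : ↥Q.Fq) :
    C (κ.toFun x) r (κ.toFun y) = - Q.ipG (κ.curv x y) r := by
  rw [h.swap_left, h.fib_vec_vec]

lemma vec_vec_fib (h : IsKCoherent Q C κ) (r : ↥Q.Kq) (x y : ↥Q.Fq) :
    C (κ.toFun x) (κ.toFun y) r = Q.ipG (κ.curv x y) r := by
  rw [h.swap_right, h.vec_fib_vec, neg_neg]

variable {Φ : L →ₗ[A] L →ₗ[A] A} {J j : ↥Q.Fq →ₗ[A] ↥Q.Kq}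

/-- For `C₂ = C₁ + dΦ`, the difference `J` of the hoists agrees with the bundle map `j`
representing `Φ` up to values orthogonal to `[𝒢, 𝒢]`. -/
lemma ipG_bracket_eq (h₁ : IsKCoherent Q C₁ κ₁) (h₂ : IsKCoherent Q C₂ κ₂)
    (hΦ_ann : ∀ r s : ↥Q.Kq, Φ r s = 0)
    (hC : ∀ X Y Z, C₂ X Y Z = C₁ X Y Z +
      dCE2 (fun X f => Q.anchor X f) (fun X Y => Q.bracket X Y) (fun X Y => Φ X Y) X Y Z)
    (hJ : ∀ x, κ₁.toFun x = κ₂.toFun x + J x)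
    (hj : ∀ x (r : ↥Q.Kq), Q.ipG (j x) r = Φ r (κ₁.toFun x)) (r s : ↥Q.Kq) (x : ↥Q.Fq) :
    Q.ipG (Q.bracket r s) (J x) = Q.ipG (Q.bracket r s) (j x) := by
  have e := hC r s (κ₁.toFun x)
  rw [h₁.fib_fib_vec, hJ x, h₂.add_right, h₂.fib_fib_vec, h₂.fib_fib_fib, ← hJ x] at e
  have a₁ := hΦ_ann ⟨_, Q.bracket_mem_ker (κ₁.toFun x) r.2⟩ s
  have a₂ := hΦ_ann ⟨_, Q.bracket_mem_ker (κ₁.toFun x) s.2⟩ r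
  have a₃ := hj x ⟨_, Q.bracket_mem_ker r s.2⟩
  have hr : Q.anchor r = 0 := r.2
  have hs : Q.anchor s = 0 := s.2
  simp only [dCE2, hr, hs, hΦ_ann, Q.bracket_skew _ (κ₁.toFun x), map_neg, LinearMap.neg_apply,
    Derivation.coe_zero, Pi.zero_apply, map_zero] at e a₁ a₂ a₃
  linear_combination -e + a₁ - a₂ - a₃ - Q.ipG_symm (Q.bracket r s) (j x)

/-- For `C₂ = C₁ + dΦ`, the covariant differentials of `J` and `j` agree. -/
lemma ipG_nabla_eq (h₁ : IsKCoherent Q C₁ κ₁) (h₂ : IsKCoherent Q C₂ κ₂)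
    (hΦ_skew : ∀ X Y, Φ X Y = - Φ Y X) (hΦ_ann : ∀ r s : ↥Q.Kq, Φ r s = 0)
    (hC : ∀ X Y Z, C₂ X Y Z = C₁ X Y Z +
      dCE2 (fun X f => Q.anchor X f) (fun X Y => Q.bracket X Y) (fun X Y => Φ X Y) X Y Z)
    (hJ : ∀ x, κ₁.toFun x = κ₂.toFun x + J x)
    (hj : ∀ x (r : ↥Q.Kq), Q.ipG (j x) r = Φ r (κ₁.toFun x)) (r : ↥Q.Kq) (x y : ↥Q.Fq) :
    Q.ipG (Q.bracket (κ₂.toFun x) (J y)) r - Q.ipG (Q.bracket (κ₂.toFun y) (J x)) r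
        - Q.ipG (J (Q.fbk x y)) r =
      Q.ipG (Q.bracket (κ₂.toFun x) (j y)) r - Q.ipG (Q.bracket (κ₂.toFun y) (j x)) r
        - Q.ipG (j (Q.fbk x y)) r := by
  have e := hC r (κ₁.toFun x) (κ₁.toFun y)
  rw [h₁.fib_vec_vec, κ₁.curv_eq_of_eq_add hJ] at e
  have lhs : C₂ r (κ₁.toFun x) (κ₁.toFun y)
      = Q.ipG (κ₂.curv x y) r - Q.ipG (Q.bracket r (J x)) (J y) := by
    rw [hJ x, hJ y, h₂.add_mid, h₂.add_right, h₂.add_right, h₂.fib_vec_vec, h₂.fib_vec_fib,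
      h₂.fib_fib_vec, h₂.fib_fib_fib]
    ring
  have hr : Q.anchor r = 0 := r.2
  have b₁ := hj y ⟨_, Q.bracket_mem_ker (κ₁.toFun x) r.2⟩
  have b₂ := hj x ⟨_, Q.bracket_mem_ker (κ₁.toFun y) r.2⟩
  have b₃ := hΦ_ann ⟨_, κ₁.curv_mem_ker x y⟩ r
  have b₄ := hΦ_skew (κ₁.toFun (Q.fbk x y)) r
  rw [lhs] at e
  simp only [dCE2, hr, κ₁.bracket_eq, Q.bracket_skew r (κ₁.toFun _), ← hj, κ₁.sect,
    κ₁.ipG_compat, map_neg, map_add, LinearMap.add_apply, map_sub, LinearMap.sub_apply,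
    LinearMap.neg_apply, Derivation.coe_zero, Pi.zero_apply] at e b₁ b₂ b₃ b₄
  have d : ∀ a b, Q.ipG (Q.bracket (κ₁.toFun a) (j b)) r =
      Q.ipG (Q.bracket (κ₂.toFun a) (j b)) r + Q.ipG (Q.bracket (J a) (j b)) r := by
    intro a b; simp only [hJ, map_add, LinearMap.add_apply]
  have A' := ipG_bracket_eq h₁ h₂ hΦ_ann hC hJ hj r
  have sk := congrArg (fun v => Q.ipG v r) (Q.bracket_skew (J x) (J y))
  simp only [map_neg, LinearMap.neg_apply] at sk
  linear_combination -e + d x y - d y x + Q.ipG_symm (Q.bracket (κ₁.toFun x) r) (j y)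
    - Q.ipG_symm (Q.bracket (κ₁.toFun y) r) (j x) + b₁ - b₂ + b₃ + b₄
    - ipG_bracket_cyc r.2 (J x).2 (j y).2 - A' (J x) y + ipG_bracket_cyc r.2 (J y).2 (j x).2
    + A' (J y) x - ipG_bracket_cyc r.2 (J y).2 (J x).2 - sk

/-- For `C₂ = C₁ + dΦ`, the relation between the 3-forms `ℋ`. -/
lemma threeForm_eq (h₂ : IsKCoherent Q C₂ κ₂)
    (hC : ∀ X Y Z, C₂ X Y Z = C₁ X Y Z +
      dCE2 (fun X f => Q.anchor X f) (fun X Y => Q.bracket X Y) (fun X Y => Φ X Y) X Y Z)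
    (hJ : ∀ x, κ₁.toFun x = κ₂.toFun x + J x)
    (hj : ∀ x (r : ↥Q.Kq), Q.ipG (j x) r = Φ r (κ₁.toFun x)) (x y z : ↥Q.Fq) :
    C₁ (κ₁.toFun x) (κ₁.toFun y) (κ₁.toFun z) =
      C₂ (κ₂.toFun x) (κ₂.toFun y) (κ₂.toFun z)
      - dCE2 Q.fact Q.fbk (fun x y => Φ (κ₁.toFun x) (κ₁.toFun y)) x y z
      + Q.ipG (κ₂.curv x y) (J z) - Q.ipG (κ₂.curv x z) (J y) + Q.ipG (κ₂.curv y z) (J x)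
      + Q.ipG (κ₁.curv x y) (j z) - Q.ipG (κ₁.curv x z) (j y) + Q.ipG (κ₁.curv y z) (j x)
      - Q.ipG (Q.bracket (J x) (J y)) (J z) := by
  have e := hC (κ₁.toFun x) (κ₁.toFun y) (κ₁.toFun z)
  have lhs : C₂ (κ₁.toFun x) (κ₁.toFun y) (κ₁.toFun z) =
      C₂ (κ₂.toFun x) (κ₂.toFun y) (κ₂.toFun z)
      + Q.ipG (κ₂.curv x y) (J z) - Q.ipG (κ₂.curv x z) (J y) + Q.ipG (κ₂.curv y z) (J x)
      - Q.ipG (Q.bracket (J x) (J y)) (J z) := by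
    rw [hJ x, hJ y, hJ z]
    simp only [h₂.add_left, h₂.add_mid, h₂.add_right, h₂.vec_vec_fib, h₂.vec_fib_vec,
      h₂.fib_vec_vec, h₂.fib_fib_vec, h₂.fib_vec_fib, h₂.vec_fib_fib, h₂.fib_fib_fib]
    ring
  have g := fun a b c => (Q.ipG_symm (κ₁.curv a b) (j c)).trans (hj c ⟨_, κ₁.curv_mem_ker a b⟩)
  rw [lhs] at e
  simp only [dCE2, κ₁.bracket_eq, κ₁.sect, map_add, LinearMap.add_apply] at e
  simp only [dCE2, QuadLieAlgebroid.fact]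
  linear_combination -e - g x y z + g x z y - g y z x

end IsKCoherent

/-- Two linear maps over an `ℝ`-algebra are the sum and the difference of two others. -/
lemma LinearMap.exists_half_add_sub {A M N : Type} [CommRing A] [Algebra ℝ A]
    [AddCommGroup M] [Module A M] [AddCommGroup N] [Module A N] (f g : M →ₗ[A] N) :
    ∃ a b : M →ₗ[A] N, f = a + b ∧ g = a - b := by
  have h : (algebraMap ℝ A 2⁻¹) + (algebraMap ℝ A 2⁻¹) = 1 := by
    rw [← map_add, ← map_one (algebraMap ℝ A)]
    norm_num
  refine ⟨algebraMap ℝ A 2⁻¹ • (f + g), algebraMap ℝ A 2⁻¹ • (f - g), ?_, ?_⟩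
  · rw [← smul_add, add_add_sub_cancel, smul_add, ← add_smul, h, one_smul]
  · rw [← smul_sub, add_sub_sub_cancel, smul_add, ← add_smul, h, one_smul]

namespace IsKCoherent
open QuadLieAlgebroid
variable {A : Type} [CommRing A] [Algebra ℝ A]
variable {L : Type} [AddCommGroup L] [Module A L] [Module ℝ L] [IsScalarTower ℝ A L]
variable {Q : QuadLieAlgebroid A L} {C₁ C₂ : L → L → L → A} {κ₁ κ₂ : Q.Hoist}

/-- The standard Courant algebroids of coherent pairs with `C₂ = C₁ + dΦ` are isomorphic: if
`κ₁ - κ₂ = K + u` and `K - u` represents `Φ`, shear by `K`. -/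
theorem exists_iso (h₁ : IsKCoherent Q C₁ κ₁) (h₂ : IsKCoherent Q C₂ κ₂)
    {Φ : L →ₗ[A] L →ₗ[A] A} (hΦ_skew : ∀ X Y, Φ X Y = - Φ Y X)
    (hΦ_ann : ∀ r s : ↥Q.Kq, Φ r s = 0)
    (hC : ∀ X Y Z, C₂ X Y Z = C₁ X Y Z +
      dCE2 (fun X f => Q.anchor X f) (fun X Y => Q.bracket X Y) (fun X Y => Φ X Y) X Y Z)
    {ca₁ ca₂ : CourantAlgebroid A (Module.Dual A ↥Q.Fq × ↥Q.Kq × ↥Q.Fq)}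
    (r₁ : RealizesES Q C₁ κ₁ ca₁) (r₂ : RealizesES Q C₂ κ₂ ca₂) :
    ∃ Θ : (Module.Dual A ↥Q.Fq × ↥Q.Kq × ↥Q.Fq) ≃ₗ[A]
        (Module.Dual A ↥Q.Fq × ↥Q.Kq × ↥Q.Fq),
      (∀ p, ca₂.rho (Θ p) = ca₁.rho p) ∧
      (∀ p q, ca₂.ip (Θ p) (Θ q) = ca₁.ip p q) ∧
      (∀ p q, Θ (ca₁.dorf p q) = ca₂.dorf (Θ p) (Θ q)) := by
  obtain ⟨J, hJ⟩ := Hoist.exists_eq_add κ₁ κ₂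
  obtain ⟨j, hj⟩ := r₁.exists_ipG_eq (Φ.compl₁₂ Q.Kq.subtype κ₁.toFun).flip
  replace hj : ∀ x (r : ↥Q.Kq), Q.ipG (j x) r = Φ r (κ₁.toFun x) := hj
  have orth := ipG_bracket_eq h₁ h₂ hΦ_ann hC hJ hj
  have flat := ipG_nabla_eq h₁ h₂ hΦ_skew hΦ_ann hC hJ hj
  have three := threeForm_eq h₂ hC hJ hj
  have curv := fun x y (t : ↥Q.Kq) => congrArg (fun v => Q.ipG v t) (Hoist.curv_eq_of_eq_add hJ x y)
  obtain ⟨K, u, rfl, rfl⟩ := LinearMap.exists_half_add_sub J j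
  simp only [LinearMap.add_apply, LinearMap.sub_apply, Submodule.coe_add, Submodule.coe_sub,
    map_add, map_sub] at orth flat three curv hJ
  have orth' : ∀ (r s : ↥Q.Kq) x, Q.ipG (Q.bracket r s) (u x) = 0 := fun r s x =>
    eq_of_two_mul_eq (by linear_combination orth r s x)
  have cen : ∀ x (r : ↥Q.Kq), Q.bracket (u x) r = 0 := fun x r =>
    Q.ipG_nondeg _ (Q.bracket_mem_ker _ r.2) fun t ht => by
      rw [ipG_bracket_cyc (u x).2 r.2 ht]
      exact orth' r ⟨t, ht⟩ x
  have cen' : ∀ x (r : ↥Q.Kq), Q.bracket r (u x) = 0 := fun x r => by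
    rw [Q.bracket_skew, cen, neg_zero]
  have flat' : ∀ (r : ↥Q.Kq) x y, Q.ipG (Q.bracket (κ₂.toFun x) (u y)) r
      - Q.ipG (Q.bracket (κ₂.toFun y) (u x)) r - Q.ipG (u (Q.fbk x y)) r = 0 := fun r x y =>
    eq_of_two_mul_eq (by linear_combination flat r x y)
  simp only [cen, cen', orth', map_zero, LinearMap.zero_apply] at three curv
  have curvK : ∀ x y (t : ↥Q.Kq), Q.ipG (κ₁.curv x y) t = Q.ipG (κ₂.curv x y) t
      + Q.ipG (Q.bracket (κ₂.toFun x) (K y)) t - Q.ipG (Q.bracket (κ₂.toFun y) (K x)) t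
      - Q.ipG (K (Q.fbk x y)) t + Q.ipG (Q.bracket (K x) (K y)) t := fun x y t => by
    linear_combination curv x y t + flat' t x y
  refine r₁.exists_iso_of_shear r₂ K
    (-(Φ.compl₁₂ κ₁.toFun κ₁.toFun) + Q.ipComp K ∘ₗ u - Q.ipComp u ∘ₗ K)
    (fun x y => ?_) (fun x s t => ?_) curvK (fun x y z => ?_)
  · simp only [LinearMap.add_apply, LinearMap.sub_apply, LinearMap.neg_apply, ipComp_apply,
      LinearMap.comp_apply, LinearMap.compl₁₂_apply]
    linear_combination -hΦ_skew (κ₁.toFun x) (κ₁.toFun y) + Q.ipG_symm (u x) (K y)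
      + Q.ipG_symm (u y) (K x)
  · simp only [hJ, map_add, LinearMap.add_apply, cen, LinearMap.zero_apply, map_zero]
    ring
  · rw [three]
    simp only [curvK]
    simp only [dCE2, LinearMap.add_apply, LinearMap.sub_apply, LinearMap.neg_apply, ipComp_apply,
      LinearMap.comp_apply, LinearMap.compl₁₂_apply, map_add, map_sub, map_neg,
      QuadLieAlgebroid.fact, κ₂.ipG_compat]
    have c := fun a b e => (ipG_bracket_cyc (K a).2 (K b).2 (K e).2)
    have o : ∀ a b e, Q.ipG (Q.bracket (K a) (K b)) (u e) = 0 := fun a b e => orth' _ _ e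
    have sk := congrArg (fun v => Q.ipG v (K y)) (Q.bracket_skew (K x) (K z))
    simp only [map_neg, LinearMap.neg_apply] at sk
    linear_combination -sk + c z x y - c x y z - o x y z + o x z y - o y z x
      - flat' (K z) x y + flat' (K y) x z - flat' (K x) y z

end IsKCoherent

open QuadLieAlgebroid in
/-- `C₂ = C₁ + dφ` with `φ ∈ C²_↔(𝒜)` implies
`E^s(C₁,κ₁) ≅ E^s(C₂,κ₂)` as Courant algebroids. -/
theorem statement17
    {A : Type} [CommRing A] [Algebra ℝ A]
    {L : Type} [AddCommGroup L] [Module A L] [Module ℝ L] [IsScalarTower ℝ A L]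
    (Q : QuadLieAlgebroid A L) (C₁ C₂ : L → L → L → A) (κ₁ κ₂ : Q.Hoist)
    (hcoh₁ : IsKCoherent Q C₁ κ₁) (hcoh₂ : IsKCoherent Q C₂ κ₂)
    -- φ ∈ C²_↔(𝒜): a 2-form on 𝒜 annihilated by all sections of ∧²𝒢
    (φ : L → L → A)
    (hφ_lin : ∀ (f : A) X X' Y, φ (f • X + X') Y = f * φ X Y + φ X' Y)
    (hφ_skew : ∀ X Y, φ X Y = - φ Y X)
    (hφ_ann : ∀ r s, r ∈ Q.Kq → s ∈ Q.Kq → φ r s = 0)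
    -- C₂ = C₁ + dφ
    (hC : ∀ X Y Z, C₂ X Y Z = C₁ X Y Z +
      dCE2 (fun X f => Q.anchor X f) (fun X Y => Q.bracket X Y) φ X Y Z) :
    -- the standard Courant algebroids E^s(C₁,κ₁) and E^s(C₂,κ₂) are isomorphic
    ∀ ca₁ ca₂ : CourantAlgebroid A (Module.Dual A ↥Q.Fq × ↥Q.Kq × ↥Q.Fq),
      RealizesES Q C₁ κ₁ ca₁ → RealizesES Q C₂ κ₂ ca₂ →
      ∃ Θ : (Module.Dual A ↥Q.Fq × ↥Q.Kq × ↥Q.Fq) ≃ₗ[A]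
          (Module.Dual A ↥Q.Fq × ↥Q.Kq × ↥Q.Fq),
        (∀ p, ca₂.rho (Θ p) = ca₁.rho p) ∧
        (∀ p q, ca₂.ip (Θ p) (Θ q) = ca₁.ip p q) ∧
        (∀ p q, Θ (ca₁.dorf p q) = ca₂.dorf (Θ p) (Θ q)) := by
  intro ca₁ ca₂ h₁ h₂
  have hφ_add : ∀ X X' Y, φ (X + X') Y = φ X Y + φ X' Y := fun X X' Y => by
    simpa using hφ_lin 1 X X' Y
  have hφ_zero : ∀ Y, φ 0 Y = 0 := fun Y => by simpa using hφ_add 0 0 Y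
  have hφ_smul : ∀ (f : A) X Y, φ (f • X) Y = f * φ X Y := fun f X Y => by
    simpa [hφ_zero] using hφ_lin f X 0 Y
  let Φ : L →ₗ[A] L →ₗ[A] A := LinearMap.mk₂ A φ hφ_add hφ_smul
    (fun X Y Y' => by rw [hφ_skew, hφ_add, hφ_skew X Y, hφ_skew X Y']; ring)
    (fun f X Y => by rw [hφ_skew, hφ_smul, hφ_skew X Y, smul_eq_mul, mul_neg])
  exact hcoh₁.exists_iso hcoh₂ (Φ := Φ) hφ_skew (fun r s => hφ_ann r s r.2 s.2) hC h₁ h₂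
end

section
/- Let 𝒜 be a regular quadratic Lie algebroid and C ∈ Γ(∧³𝒜*) a coherent 3-form. Then a 3-form C' ∈ Γ(∧³𝒜*) is coherent if and only if C' = C + a*(ϖ) + dΦ_J for some d^F-closed 3-form ϖ ∈ Γ(∧³F*) and some bundle map J : F → 𝒢. -/
open QuadLieAlgebroid in
/-- the 2-form `Φ_J(r+x, s+y) = ⟨r,J(y)⟩_𝒢 − ⟨s,J(x)⟩_𝒢` on `𝒜`, written via the
splitting `𝒜 ≅ 𝒢⊕F` determined by the hoist `κ` -/
def PhiJform
    {A : Type} [CommRing A] [Algebra ℝ A]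
    {L : Type} [AddCommGroup L] [Module A L] [Module ℝ L] [IsScalarTower ℝ A L]
    {Q : QuadLieAlgebroid A L} (κ : Q.Hoist) (J : ↥Q.Fq →ₗ[A] ↥Q.Kq)
    (X Y : L) : A :=
  Q.ipG (X - κ.toFun (Q.anchor.rangeRestrict X)) ↑(J (Q.anchor.rangeRestrict Y))
    - Q.ipG (Y - κ.toFun (Q.anchor.rangeRestrict Y)) ↑(J (Q.anchor.rangeRestrict X))

/-- Alternating trilinear functions, in the elementary form used for 3-forms. -/
def IsThreeForm {A V : Type} [CommRing A] [AddCommGroup V] [Module A V]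
    (C : V → V → V → A) : Prop :=
  (∀ (f : A) X X' Y Z, C (f • X + X') Y Z = f * C X Y Z + C X' Y Z) ∧
  (∀ X Y Z, C X Y Z = - C Y X Z) ∧
  (∀ X Y Z, C X Y Z = - C X Z Y)

namespace IsThreeForm

variable {A V : Type} [CommRing A] [AddCommGroup V] [Module A V] {C D : V → V → V → A}

lemma add_left (h : IsThreeForm C) (X X' Y Z : V) : C (X + X') Y Z = C X Y Z + C X' Y Z := by
  simpa using h.1 1 X X' Y Z

lemma zero_left (h : IsThreeForm C) (Y Z : V) : C 0 Y Z = 0 := by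
  have := h.add_left 0 0 Y Z
  rw [add_zero] at this
  linear_combination -this

lemma add_mid (h : IsThreeForm C) (X Y Y' Z : V) : C X (Y + Y') Z = C X Y Z + C X Y' Z := by
  rw [h.2.1, h.add_left, h.2.1 X, h.2.1 X]; ring

lemma add_right (h : IsThreeForm C) (X Y Z Z' : V) : C X Y (Z + Z') = C X Y Z + C X Y Z' := by
  rw [h.2.2, h.add_mid, h.2.2 X Y, h.2.2 X Y]; ring

lemma neg_left (h : IsThreeForm C) (X Y Z : V) : C (-X) Y Z = - C X Y Z := by
  have := h.add_left X (-X) Y Z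
  rw [add_neg_cancel, h.zero_left] at this
  linear_combination -this

lemma neg_mid (h : IsThreeForm C) (X Y Z : V) : C X (-Y) Z = - C X Y Z := by
  rw [h.2.1, h.neg_left, h.2.1 X]

lemma neg_right (h : IsThreeForm C) (X Y Z : V) : C X Y (-Z) = - C X Y Z := by
  rw [h.2.2, h.neg_mid, h.2.2 X Y]

lemma sub_left (h : IsThreeForm C) (X X' Y Z : V) : C (X - X') Y Z = C X Y Z - C X' Y Z := by
  rw [sub_eq_add_neg, h.add_left, h.neg_left, sub_eq_add_neg]

lemma sub_mid (h : IsThreeForm C) (X Y Y' Z : V) : C X (Y - Y') Z = C X Y Z - C X Y' Z := by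
  rw [sub_eq_add_neg, h.add_mid, h.neg_mid, sub_eq_add_neg]

lemma sub_right (h : IsThreeForm C) (X Y Z Z' : V) : C X Y (Z - Z') = C X Y Z - C X Y Z' := by
  rw [sub_eq_add_neg, h.add_right, h.neg_right, sub_eq_add_neg]

protected lemma add (hC : IsThreeForm C) (hD : IsThreeForm D) :
    IsThreeForm fun X Y Z => C X Y Z + D X Y Z := by
  refine ⟨fun f X X' Y Z => ?_, fun X Y Z => ?_, fun X Y Z => ?_⟩
  · linear_combination hC.1 f X X' Y Z + hD.1 f X X' Y Z
  · linear_combination hC.2.1 X Y Z + hD.2.1 X Y Z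
  · linear_combination hC.2.2 X Y Z + hD.2.2 X Y Z

protected lemma sub (hC : IsThreeForm C) (hD : IsThreeForm D) :
    IsThreeForm fun X Y Z => C X Y Z - D X Y Z := by
  refine ⟨fun f X X' Y Z => ?_, fun X Y Z => ?_, fun X Y Z => ?_⟩
  · linear_combination hC.1 f X X' Y Z - hD.1 f X X' Y Z
  · linear_combination hC.2.1 X Y Z - hD.2.1 X Y Z
  · linear_combination hC.2.2 X Y Z - hD.2.2 X Y Z

/-- Pullback of a 3-form along a linear map. -/
lemma comp {W : Type} [AddCommGroup W] [Module A W] (hC : IsThreeForm C) (g : W →ₗ[A] V) :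
    IsThreeForm fun X Y Z => C (g X) (g Y) (g Z) := by
  refine ⟨fun f X X' Y Z => ?_, fun X Y Z => hC.2.1 _ _ _, fun X Y Z => hC.2.2 _ _ _⟩
  simp only [map_add, map_smul, hC.1]

end IsThreeForm

namespace QuadLieAlgebroid

variable {A : Type} [CommRing A] [Algebra ℝ A]
variable {L : Type} [AddCommGroup L] [Module A L] [Module ℝ L] [IsScalarTower ℝ A L]
variable {Q : QuadLieAlgebroid A L}

lemma anchor_bracket_apply (X Y : L) (f : A) :
    Q.anchor (Q.bracket X Y) f = Q.anchor X (Q.anchor Y f) - Q.anchor Y (Q.anchor X f) := by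
  rw [Q.anchor_bracket, Derivation.commutator_apply]

lemma bracket_smul_left (f : A) (X Y : L) :
    Q.bracket (f • X) Y = f • Q.bracket X Y - Q.anchor Y f • X := by
  rw [Q.bracket_skew, Q.leibniz, Q.bracket_skew Y X, smul_neg]; abel

lemma rangeRestrict_bracket (X Y : L) :
    Q.anchor.rangeRestrict (Q.bracket X Y)
      = Q.fbk (Q.anchor.rangeRestrict X) (Q.anchor.rangeRestrict Y) :=
  Subtype.ext (Q.anchor_bracket X Y)

lemma rangeRestrict_of_mem {r : L} (hr : r ∈ Q.Kq) : Q.anchor.rangeRestrict r = 0 :=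
  Subtype.ext hr

lemma Hoist.rangeRestrict_toFun (κ : Q.Hoist) (x : ↥Q.Fq) :
    Q.anchor.rangeRestrict (κ.toFun x) = x :=
  Subtype.ext (κ.sect x)

lemma Hoist.sub_toFun_mem (κ : Q.Hoist) (X : L) :
    X - κ.toFun (Q.anchor.rangeRestrict X) ∈ Q.Kq := by
  rw [LinearMap.mem_ker, map_sub, κ.sect]
  exact sub_self _

/-- The differential `d` on 2-forms of the Lie algebroid. -/
local notation "d₂" => dCE2 (fun X f => Q.anchor X f) (fun X Y => Q.bracket X Y)

/-- The differential `d` on 3-forms of the Lie algebroid. -/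
local notation "d₃" => dCE3 (fun X f => Q.anchor X f) (fun X Y => Q.bracket X Y)

lemma isThreeForm_dCE2 (ω : L →ₗ[A] L →ₗ[A] A) (hω : ∀ X Y, ω X Y = - ω Y X) :
    IsThreeForm (d₂ fun X Y => ω X Y) := by
  refine ⟨fun f X X' Y Z => ?_, fun X Y Z => ?_, fun X Y Z => ?_⟩
  · simp only [dCE2, map_add, map_smul, LinearMap.add_apply, LinearMap.smul_apply, smul_eq_mul,
      Derivation.leibniz, bracket_smul_left, map_sub, LinearMap.sub_apply, Derivation.add_apply,
      Derivation.smul_apply]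
    rw [hω (Q.bracket Y Z) X, hω (Q.bracket Y Z) X']
    ring
  · simp only [dCE2]
    rw [Q.bracket_skew Y X, hω Y X]
    simp only [map_neg, LinearMap.neg_apply]
    ring
  · simp only [dCE2]
    rw [Q.bracket_skew Z Y, hω Z Y]
    simp only [map_neg, LinearMap.neg_apply]
    ring

lemma dCE3_dCE2 (ω : L →ₗ[A] L →ₗ[A] A) (hω : ∀ X Y, ω X Y = - ω Y X) (X₀ X₁ X₂ X₃ : L) :
    d₃ (d₂ fun X Y => ω X Y) X₀ X₁ X₂ X₃ = 0 := by
  have hJ : ∀ X Y Z W, ω (Q.bracket (Q.bracket X Y) Z) W - ω (Q.bracket (Q.bracket X Z) Y) W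
      + ω (Q.bracket (Q.bracket Y Z) X) W = 0 := by
    intro X Y Z W
    rw [Q.bracket_skew (Q.bracket X Z) Y, Q.bracket_skew (Q.bracket Y Z) X, Q.jacobi X Y Z]
    simp only [map_neg, map_add, LinearMap.neg_apply, LinearMap.add_apply]
    ring
  simp only [dCE3, dCE2, map_add, map_sub, anchor_bracket_apply]
  rw [hω (Q.bracket X₂ X₃) (Q.bracket X₀ X₁), hω (Q.bracket X₁ X₃) (Q.bracket X₀ X₂),
    hω (Q.bracket X₁ X₂) (Q.bracket X₀ X₃)]
  linear_combination hJ X₀ X₁ X₂ X₃ - hJ X₀ X₁ X₃ X₂ + hJ X₀ X₂ X₃ X₁ - hJ X₁ X₂ X₃ X₀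

lemma dCE3_add (C D : L → L → L → A) (X₀ X₁ X₂ X₃ : L) :
    d₃ (fun X Y Z => C X Y Z + D X Y Z) X₀ X₁ X₂ X₃ = d₃ C X₀ X₁ X₂ X₃ + d₃ D X₀ X₁ X₂ X₃ := by
  simp only [dCE3, map_add]; ring

lemma dCE3_sub (C D : L → L → L → A) (X₀ X₁ X₂ X₃ : L) :
    d₃ (fun X Y Z => C X Y Z - D X Y Z) X₀ X₁ X₂ X₃ = d₃ C X₀ X₁ X₂ X₃ - d₃ D X₀ X₁ X₂ X₃ := by
  simp only [dCE3, map_sub]; ring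

/-- The pullback along the anchor is a cochain map. -/
lemma dCE3_pullback (ϖ : ↥Q.Fq → ↥Q.Fq → ↥Q.Fq → A) (X₀ X₁ X₂ X₃ : L) :
    d₃ (fun X Y Z => ϖ (Q.anchor.rangeRestrict X) (Q.anchor.rangeRestrict Y)
        (Q.anchor.rangeRestrict Z)) X₀ X₁ X₂ X₃
      = dCE3 Q.fact Q.fbk ϖ (Q.anchor.rangeRestrict X₀) (Q.anchor.rangeRestrict X₁)
        (Q.anchor.rangeRestrict X₂) (Q.anchor.rangeRestrict X₃) := by
  simp only [dCE3, rangeRestrict_bracket]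
  rfl

/-- The 2-form `Φ_J` as a bilinear map. -/
def phiLin (κ : Q.Hoist) (J : ↥Q.Fq →ₗ[A] ↥Q.Kq) : L →ₗ[A] L →ₗ[A] A :=
  let B := Q.ipG.compl₁₂ (LinearMap.id - κ.toFun.comp Q.anchor.rangeRestrict)
    (Q.Kq.subtype.comp (J.comp Q.anchor.rangeRestrict))
  B - B.flip

lemma phiLin_apply (κ : Q.Hoist) (J : ↥Q.Fq →ₗ[A] ↥Q.Kq) (X Y : L) :
    phiLin κ J X Y = PhiJform κ J X Y := rfl

lemma phiLin_skew (κ : Q.Hoist) (J : ↥Q.Fq →ₗ[A] ↥Q.Kq) (X Y : L) :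
    phiLin κ J X Y = - phiLin κ J Y X := by
  simp only [phiLin_apply, PhiJform]; ring

lemma isThreeForm_dPhi (κ : Q.Hoist) (J : ↥Q.Fq →ₗ[A] ↥Q.Kq) :
    IsThreeForm (d₂ (PhiJform κ J)) :=
  isThreeForm_dCE2 (phiLin κ J) (phiLin_skew κ J)

section Evaluation

variable (κ : Q.Hoist) (J : ↥Q.Fq →ₗ[A] ↥Q.Kq)

lemma PhiJform_ker_ker {r s : L} (hr : r ∈ Q.Kq) (hs : s ∈ Q.Kq) : PhiJform κ J r s = 0 := by
  simp [PhiJform, rangeRestrict_of_mem hr, rangeRestrict_of_mem hs]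

lemma PhiJform_ker_left {r : L} (hr : r ∈ Q.Kq) (Y : L) :
    PhiJform κ J r Y = Q.ipG r (J (Q.anchor.rangeRestrict Y)) := by
  simp [PhiJform, rangeRestrict_of_mem hr]

lemma PhiJform_ker_right {r : L} (hr : r ∈ Q.Kq) (Y : L) :
    PhiJform κ J Y r = - Q.ipG r (J (Q.anchor.rangeRestrict Y)) := by
  simp [PhiJform, rangeRestrict_of_mem hr]

lemma bracket_mem_ker_left {r : L} (hr : r ∈ Q.Kq) (X : L) : Q.bracket r X ∈ Q.Kq := by
  rw [Q.bracket_skew]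
  exact neg_mem (Q.bracket_mem_ker X hr)

lemma dPhi_ker_ker {r s : L} (hr : r ∈ Q.Kq) (hs : s ∈ Q.Kq) (X : L) :
    d₂ (PhiJform κ J) r s X = - Q.ipG (Q.bracket r s) (J (Q.anchor.rangeRestrict X)) := by
  have hr0 : Q.anchor r = 0 := hr
  have hs0 : Q.anchor s = 0 := hs
  simp only [dCE2, hr0, hs0, Derivation.zero_apply, PhiJform_ker_ker κ J hr hs, map_zero,
    PhiJform_ker_left κ J (Q.bracket_mem_ker r hs),
    PhiJform_ker_ker κ J (bracket_mem_ker_left hr X) hs,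
    PhiJform_ker_ker κ J (bracket_mem_ker_left hs X) hr]
  ring

lemma dPhi_ker_toFun_toFun {r : L} (hr : r ∈ Q.Kq) (x y : ↥Q.Fq) :
    d₂ (PhiJform κ J) r (κ.toFun x) (κ.toFun y)
      = Q.ipG r (J (Q.fbk x y)) - Q.ipG r (Q.bracket (κ.toFun x) (J y))
        + Q.ipG r (Q.bracket (κ.toFun y) (J x)) := by
  have hr0 : Q.anchor r = 0 := hr
  simp only [dCE2, hr0, Derivation.zero_apply, PhiJform_ker_left κ J hr,
    PhiJform_ker_left κ J (bracket_mem_ker_left hr _), PhiJform_ker_right κ J hr,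
    rangeRestrict_bracket, κ.rangeRestrict_toFun, Q.ipG_inv _ _ _ hr (J _).2]
  rw [Q.bracket_skew r, Q.bracket_skew r]
  simp only [map_neg, LinearMap.neg_apply]
  ring

end Evaluation

lemma Hoist.sub_toFun (κ : Q.Hoist) (J : ↥Q.Fq →ₗ[A] ↥Q.Kq) (x : ↥Q.Fq) :
    (κ.sub J).toFun x = κ.toFun x - (J x : L) := rfl

/-- If `C` is `κ`-coherent, then `C + dΦ_J` is `(κ - J)`-coherent. -/
lemma isKCoherent_add_dPhi {C : L → L → L → A} {κ : Q.Hoist} (h : IsKCoherent Q C κ)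
    (J : ↥Q.Fq →ₗ[A] ↥Q.Kq) :
    IsKCoherent Q (fun X Y Z => C X Y Z + d₂ (PhiJform κ J) X Y Z) (κ.sub J) := by
  obtain ⟨h1, h2, h3, hd, hk, hm, hc⟩ := h
  have hC : IsThreeForm C := ⟨h1, h2, h3⟩
  have hP := isThreeForm_dPhi κ J
  obtain ⟨g1, g2, g3⟩ := hC.add hP
  refine ⟨g1, g2, g3, fun X₀ X₁ X₂ X₃ => ?_, fun r s t hr hs ht => ?_,
    fun r s hr hs x => ?_, fun r hr x y => ?_⟩
  · rw [dCE3_add, hd, zero_add]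
    exact dCE3_dCE2 (phiLin κ J) (phiLin_skew κ J) _ _ _ _
  · beta_reduce
    rw [hk r s t hr hs ht, dPhi_ker_ker κ J hr hs, rangeRestrict_of_mem ht]
    simp
  · beta_reduce
    rw [dPhi_ker_ker κ J hr hs, (κ.sub J).rangeRestrict_toFun, Hoist.sub_toFun, hC.sub_right,
      hm r s hr hs, hk r s _ hr hs (J x).2]
    ring
  · have hJJ : d₂ (PhiJform κ J) r (J x) (J y) = 0 := by
      rw [dPhi_ker_ker κ J hr (J x).2, rangeRestrict_of_mem (J y).2]; simp
    have hinv : Q.ipG (Q.bracket r (J y)) (J x) = - Q.ipG r (Q.bracket (J x) (J y)) := by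
      have h0 := Q.ipG_inv (J y) r (J x) hr (J x).2
      rw [show Q.anchor (J y : L) = 0 from (J y).2, Derivation.zero_apply,
        Q.bracket_skew _ r, Q.bracket_skew (J y : L) (J x)] at h0
      simp only [map_neg, LinearMap.neg_apply] at h0
      linear_combination h0
    simp only [Hoist.curv, Hoist.sub_toFun, hC.sub_mid, hC.sub_right, hP.sub_mid, hP.sub_right,
      hJJ, dPhi_ker_toFun_toFun κ J hr, dPhi_ker_ker κ J hr (J x).2, κ.rangeRestrict_toFun,
      h3 r (κ.toFun x) (J y), hP.2.2 r (κ.toFun x) (J y), dPhi_ker_ker κ J hr (J y).2,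
      hm r _ hr (J x).2, hm r _ hr (J y).2, hk r _ _ hr (J x).2 (J y).2, hc r hr, map_sub,
      LinearMap.sub_apply, hinv]
    rw [Q.bracket_skew (J x : L) (κ.toFun y), map_neg]
    ring

/-- Coherence is preserved by adding the pullback of a closed leafwise 3-form. -/
lemma isKCoherent_add_pullback {C : L → L → L → A} {κ : Q.Hoist} (h : IsKCoherent Q C κ)
    {ϖ : ↥Q.Fq → ↥Q.Fq → ↥Q.Fq → A} (hϖ : IsThreeForm ϖ)
    (hcl : ∀ x₀ x₁ x₂ x₃, dCE3 Q.fact Q.fbk ϖ x₀ x₁ x₂ x₃ = 0) :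
    IsKCoherent Q (fun X Y Z => C X Y Z + ϖ (Q.anchor.rangeRestrict X)
      (Q.anchor.rangeRestrict Y) (Q.anchor.rangeRestrict Z)) κ := by
  obtain ⟨h1, h2, h3, hd, hk, hm, hc⟩ := h
  have hC : IsThreeForm C := ⟨h1, h2, h3⟩
  obtain ⟨g1, g2, g3⟩ := hC.add (hϖ.comp Q.anchor.rangeRestrict)
  refine ⟨g1, g2, g3, fun X₀ X₁ X₂ X₃ => ?_, fun r s t hr hs ht => ?_,
    fun r s hr hs x => ?_, fun r hr x y => ?_⟩
  · rw [dCE3_add, hd, dCE3_pullback, hcl, zero_add]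
  · beta_reduce
    rw [rangeRestrict_of_mem hr, hϖ.zero_left, add_zero, hk r s t hr hs ht]
  · beta_reduce
    rw [rangeRestrict_of_mem hr, hϖ.zero_left, add_zero, hm r s hr hs]
  · beta_reduce
    rw [rangeRestrict_of_mem hr, hϖ.zero_left, add_zero, hc r hr]

/-- Two 3-forms coherent with respect to the same hoist agree as soon as one argument is
in the kernel of the anchor. -/
lemma eq_of_mem_ker_of_isKCoherent {C C' : L → L → L → A} {κ : Q.Hoist}
    (h : IsKCoherent Q C κ) (h' : IsKCoherent Q C' κ) {r : L} (hr : r ∈ Q.Kq) (Y Z : L) :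
    C' r Y Z = C r Y Z := by
  obtain ⟨h1, h2, h3, -, hk, hm, hc⟩ := h
  obtain ⟨h1', h2', h3', -, hk', hm', hc'⟩ := h'
  have hC : IsThreeForm C := ⟨h1, h2, h3⟩
  have hC' : IsThreeForm C' := ⟨h1', h2', h3'⟩
  have hY := κ.sub_toFun_mem Y
  have hZ := κ.sub_toFun_mem Z
  rw [← sub_add_cancel Y (κ.toFun (Q.anchor.rangeRestrict Y)),
    ← sub_add_cancel Z (κ.toFun (Q.anchor.rangeRestrict Z))]
  generalize Y - κ.toFun (Q.anchor.rangeRestrict Y) = s at hY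
  generalize Z - κ.toFun (Q.anchor.rangeRestrict Z) = t at hZ
  generalize Q.anchor.rangeRestrict Y = y
  generalize Q.anchor.rangeRestrict Z = z
  rw [hC.add_mid, hC.add_right, hC.add_right, hC'.add_mid, hC'.add_right, hC'.add_right,
    hk r s t hr hY hZ, hk' r s t hr hY hZ, hm r s hr hY, hm' r s hr hY, h3 r (κ.toFun y) t,
    h3' r (κ.toFun y) t, hm r t hr hZ, hm' r t hr hZ, hc r hr, hc' r hr]

/-- A 3-form vanishing on the kernel of the anchor is the pullback of its restriction
along any hoist. -/
lemma Hoist.eq_pullback (κ : Q.Hoist) {D : L → L → L → A} (hD : IsThreeForm D)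
    (h0 : ∀ r ∈ Q.Kq, ∀ Y Z, D r Y Z = 0) (X Y Z : L) :
    D X Y Z = D (κ.toFun (Q.anchor.rangeRestrict X)) (κ.toFun (Q.anchor.rangeRestrict Y))
      (κ.toFun (Q.anchor.rangeRestrict Z)) := by
  have key : ∀ X Y Z, D X Y Z = D (κ.toFun (Q.anchor.rangeRestrict X)) Y Z := fun X Y Z => by
    rw [← sub_eq_zero, ← hD.sub_left, h0 _ (κ.sub_toFun_mem X)]
  rw [key X Y Z, hD.2.1, key Y, hD.2.1, neg_neg, hD.2.2, hD.2.1, key Z, hD.2.1, hD.2.2,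
    neg_neg, neg_neg]

/-- Two 3-forms coherent with respect to the same hoist differ by the pullback of a closed
leafwise 3-form. -/
lemma exists_pullback_of_isKCoherent {C C' : L → L → L → A} {κ : Q.Hoist}
    (h : IsKCoherent Q C κ) (h' : IsKCoherent Q C' κ) :
    ∃ ϖ : ↥Q.Fq → ↥Q.Fq → ↥Q.Fq → A, IsThreeForm ϖ ∧
      (∀ x₀ x₁ x₂ x₃, dCE3 Q.fact Q.fbk ϖ x₀ x₁ x₂ x₃ = 0) ∧
      ∀ X Y Z, C' X Y Z = C X Y Z + ϖ (Q.anchor.rangeRestrict X) (Q.anchor.rangeRestrict Y)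
        (Q.anchor.rangeRestrict Z) := by
  let D : L → L → L → A := fun X Y Z => C' X Y Z - C X Y Z
  have hD : IsThreeForm D :=
    IsThreeForm.sub ⟨h'.1, h'.2.1, h'.2.2.1⟩ ⟨h.1, h.2.1, h.2.2.1⟩
  have hpull := κ.eq_pullback hD fun r hr Y Z =>
    sub_eq_zero.2 (eq_of_mem_ker_of_isKCoherent h h' hr Y Z)
  refine ⟨fun x y z => D (κ.toFun x) (κ.toFun y) (κ.toFun z), hD.comp κ.toFun,
    fun x₀ x₁ x₂ x₃ => ?_, fun X Y Z => ?_⟩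
  · have hdD : d₃ D (κ.toFun x₀) (κ.toFun x₁) (κ.toFun x₂) (κ.toFun x₃) = 0 := by
      rw [dCE3_sub, h'.2.2.2.1, h.2.2.2.1, sub_zero]
    rw [show D = fun X Y Z => D (κ.toFun (Q.anchor.rangeRestrict X))
        (κ.toFun (Q.anchor.rangeRestrict Y)) (κ.toFun (Q.anchor.rangeRestrict Z)) from
      funext fun X => funext fun Y => funext fun Z => hpull X Y Z] at hdD
    rw [dCE3_pullback (fun x y z => D (κ.toFun x) (κ.toFun y) (κ.toFun z))] at hdD
    simpa only [κ.rangeRestrict_toFun] using hdD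
  · beta_reduce
    rw [← hpull]
    simp [D]

/-- The difference of two hoists, as a bundle map `F → 𝒢`. -/
def Hoist.diff (κ κ' : Q.Hoist) : ↥Q.Fq →ₗ[A] ↥Q.Kq :=
  (κ.toFun - κ'.toFun).codRestrict Q.Kq fun x => by
    rw [LinearMap.mem_ker, LinearMap.sub_apply, map_sub, κ.sect, κ'.sect, sub_self]

lemma Hoist.sub_diff (κ κ' : Q.Hoist) : κ.sub (κ.diff κ') = κ' := by
  have h : (κ.sub (κ.diff κ')).toFun = κ'.toFun := by
    ext x
    rw [Hoist.sub_toFun]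
    simp [Hoist.diff]
  cases κ'
  exact Hoist.mk.injEq _ _ _ _ |>.mpr h

end QuadLieAlgebroid

open QuadLieAlgebroid in
/-- Description of all coherent 3-forms: `C'` is coherent iff
`C' = C + a*(ϖ) + dΦ_J` with `ϖ ∈ Γ(∧³F*)` a `d^F`-closed leafwise 3-form and
`J : F → 𝒢` a bundle map. -/
theorem statement19
    {A : Type} [CommRing A] [Algebra ℝ A]
    {L : Type} [AddCommGroup L] [Module A L] [Module ℝ L] [IsScalarTower ℝ A L]
    (Q : QuadLieAlgebroid A L) (C : L → L → L → A) (κ : Q.Hoist)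
    (hcoh : IsKCoherent Q C κ) :
    ∀ C' : L → L → L → A,
      (∃ κ' : Q.Hoist, IsKCoherent Q C' κ') ↔
      (∃ (ϖ : ↥Q.Fq → ↥Q.Fq → ↥Q.Fq → A) (J : ↥Q.Fq →ₗ[A] ↥Q.Kq),
        -- ϖ is a leafwise 3-form: alternating and C^∞(M)-multilinear ...
        (∀ (f : A) x x' y z, ϖ (f • x + x') y z = f * ϖ x y z + ϖ x' y z) ∧
        (∀ x y z, ϖ x y z = - ϖ y x z) ∧
        (∀ x y z, ϖ x y z = - ϖ x z y) ∧
        -- ... which is d^F-closed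
        (∀ x₀ x₁ x₂ x₃, dCE3 Q.fact Q.fbk ϖ x₀ x₁ x₂ x₃ = 0) ∧
        -- C' = C + a*(ϖ) + dΦ_J
        (∀ X Y Z, C' X Y Z = C X Y Z
          + ϖ (Q.anchor.rangeRestrict X) (Q.anchor.rangeRestrict Y)
              (Q.anchor.rangeRestrict Z)
          + dCE2 (fun X f => Q.anchor X f) (fun X Y => Q.bracket X Y)
              (PhiJform κ J) X Y Z)) := by
  intro C'
  constructor
  · rintro ⟨κ', h'⟩
    have hJ := isKCoherent_add_dPhi hcoh (κ.diff κ')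
    rw [κ.sub_diff] at hJ
    obtain ⟨ϖ, ⟨w1, w2, w3⟩, hcl, hϖ⟩ := exists_pullback_of_isKCoherent hJ h'
    exact ⟨ϖ, κ.diff κ', w1, w2, w3, hcl, fun X Y Z => by rw [hϖ, add_right_comm]⟩
  · rintro ⟨ϖ, J, w1, w2, w3, hcl, hϖ⟩
    refine ⟨κ.sub J, ?_⟩
    have hK := isKCoherent_add_pullback (isKCoherent_add_dPhi hcoh J) ⟨w1, w2, w3⟩ hcl
    convert hK using 1
    funext X Y Z
    rw [hϖ, add_right_comm]
end
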